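/- Universality of the canonical accessibility relation: the relation R = {⟨Γ,Δ⟩ ∈ MC × MC : for every formula A, □A ∈ Γ implies A ∈ Δ} is the universal relation on MC, i.e., for all Γ, Δ ∈ MC and every formula A, if □A ∈ Γ then A ∈ Δ. -/

import Mathlib

namespace FOLBoxPaper

/-- Formulas of the language L(∀,□): atoms `P_j(x₁,…,xₙ)` (predicate index and
list of variables), identity `x = y`, negation, implication, universal
quantification, and the modal operator □. Variables are natural numbers. -/
inductive Formula : Type
  | atom : ℕ → List ℕ → Formula
  | eq : ℕ → ℕ → Formula
  | neg : Formula → Formula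
  | imp : Formula → Formula → Formula
  | all : ℕ → Formula → Formula
  | box : Formula → Formula

namespace Formula

/-- Conjunction, defined as usual. -/
def and (A B : Formula) : Formula := neg (imp A (neg B))

/-- Disjunction, defined as usual. -/
def or (A B : Formula) : Formula := imp (neg A) B

/-- Biconditional, defined as usual. -/
def iff (A B : Formula) : Formula := (imp A B).and (imp B A)

/-- ◇A := ¬□¬A. -/
def dia (A : Formula) : Formula := neg (box (neg A))

/-- ∃xA := ¬∀x¬A. -/
def ex (x : ℕ) (A : Formula) : Formula := neg (all x (neg A))

/-- A formula is □-free when it contains no occurrence of □. -/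
def BoxFree : Formula → Prop
  | atom _ _ => True
  | eq _ _ => True
  | neg A => BoxFree A
  | imp A B => BoxFree A ∧ BoxFree B
  | all _ A => BoxFree A
  | box _ => False

/-- `FreeIn x A`: the variable x has at least one ∀□-free occurrence in A,
i.e. an occurrence that is neither in the scope of a quantifier binding x
nor in the scope of □. -/
def FreeIn (x : ℕ) : Formula → Prop
  | atom _ args => x ∈ args
  | eq a b => x = a ∨ x = b
  | neg A => FreeIn x A
  | imp A B => FreeIn x A ∨ FreeIn x B
  | all z A => z ≠ x ∧ FreeIn x A
  | box _ => False

/-- The ∀□-free substitution `A(y/x)`: replace every ∀□-free occurrence of x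
in A by y (occurrences in the scope of □ or of a quantifier binding x are
left untouched). -/
def subst (A : Formula) (y x : ℕ) : Formula :=
  match A with
  | atom j args => atom j (args.map fun z => if z = x then y else z)
  | eq a b => eq (if a = x then y else a) (if b = x then y else b)
  | neg A => neg (subst A y x)
  | imp A B => imp (subst A y x) (subst B y x)
  | all z A => if z = x then all z A else all z (subst A y x)
  | box A => box A

/-- `Substitutable y x A`: the variable y is substitutable for the ∀□-free
occurrences of x in A, i.e. y is not captured by a quantifier when it
replaces x. -/
def Substitutable (y x : ℕ) : Formula → Prop
  | atom _ _ => True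
  | eq _ _ => True
  | neg A => Substitutable y x A
  | imp A B => Substitutable y x A ∧ Substitutable y x B
  | all z A => z = x ∨ ¬ FreeIn x A ∨ (z ≠ y ∧ Substitutable y x A)
  | box _ => True

end Formula

open Formula

/-- A first-order structure with variable domains:
a nonempty set of possible worlds, a nonempty domain of objects for each
world, and a world-relative interpretation of the predicate symbols. -/
structure Structure where
  W : Type
  wNonempty : Nonempty W
  D : W → Type
  dNonempty : ∀ w, Nonempty (D w)
  I : ℕ → (w : W) → List (D w) → Prop

/-- A valuation assigns, to each variable and world, an object of the domain
of that world. -/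
def Valuation (M : Structure) : Type := ℕ → (w : M.W) → M.D w

open Classical in
/-- The variant `v^a_x(w)` of a valuation v at world w: it maps x at w to a
and agrees with v everywhere else. -/
noncomputable def updateVal {M : Structure} (v : Valuation M) (x : ℕ)
    (w : M.W) (a : M.D w) : Valuation M :=
  fun y w' => if h : y = x ∧ w' = w then cast (congrArg M.D h.2.symm) a else v y w'

/-- Satisfaction `M, v, w ⊨ A`. The clause for □ quantifies over all
valuations and all worlds of the structure. -/
def Sat (M : Structure) : Valuation M → M.W → Formula → Prop
  | v, w, .atom j args => M.I j w (args.map fun z => v z w)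
  | v, w, .eq a b => v a w = v b w
  | v, w, .neg A => ¬ Sat M v w A
  | v, w, .imp A B => Sat M v w A → Sat M v w B
  | v, w, .all x A => ∀ a : M.D w, Sat M (updateVal v x w a) w A
  | _, _, .box A => ∀ (v' : Valuation M) (w' : M.W), Sat M v' w' A

/-- `M ⊨ A`: A is satisfied at every valuation and world of M. -/
def Models (M : Structure) (A : Formula) : Prop := ∀ v w, Sat M v w A

/-- Universal structures: M is universal when every □-free formula true
everywhere in M is true everywhere in every structure. -/
def Universal (M : Structure) : Prop :=
  ∀ B, BoxFree B → Models M B → ∀ N : Structure, Models N B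

/-- Logical validity: truth at every valuation and world of every universal
structure. -/
def Valid (A : Formula) : Prop :=
  ∀ M : Structure, Universal M → ∀ (v : Valuation M) (w : M.W), Sat M v w A

/-- FOL: the set of □-free classical first-order theses, i.e. □-free formulas
satisfied at every valuation and world of every structure. -/
def FOL : Set Formula := {A | BoxFree A ∧ ∀ M : Structure, Models M A}

/-- `PropTaut A`: A is an instantiation of a tautology of classical
propositional logic (it is true under every assignment of truth values to
formulas that respects ¬ and →). -/
def PropTaut (A : Formula) : Prop :=
  ∀ f : Formula → Prop,
    (∀ B, f (neg B) ↔ ¬ f B) → (∀ B C, f (imp B C) ↔ (f B → f C)) → f A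

/-- The system FOL□. -/
inductive FOLBox : Formula → Prop
  | taut {A} : PropTaut A → FOLBox A
  | axK {A B} : FOLBox ((box (A.imp B)).imp ((box A).imp (box B)))
  | axT {A} : FOLBox ((box A).imp A)
  | ax5 {A} : FOLBox ((neg (box A)).imp (box (neg (box A))))
  | axAll1 {A : Formula} {x y : ℕ} : Substitutable y x A →
      FOLBox ((all x A).imp (A.subst y x))
  | axAll2 {A B : Formula} {x : ℕ} : ¬ FreeIn x A →
      FOLBox ((all x (A.imp B)).imp (A.imp (all x B)))
  | axId {x : ℕ} : FOLBox (Formula.eq x x)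
  | axEq {A : Formula} {x y : ℕ} : BoxFree A → Substitutable y x A →
      FOLBox (((Formula.eq x y).and A).imp (A.subst y x))
  | axMix {A : Formula} {x : ℕ} : FOLBox ((box A).imp (all x A))
  | axBang {A} : BoxFree A → A ∉ FOL → FOLBox (neg (box A))
  | mp {A B} : FOLBox (A.imp B) → FOLBox A → FOLBox B
  | nec {A} : FOLBox A → FOLBox (box A)

/-- The conjunction of a (nonempty) finite list of formulas. -/
def conjList : List Formula → Formula
  | [] => Formula.eq 0 0
  | [A] => A
  | A :: B :: rest => A.and (conjList (B :: rest))

/-- FOL□-consistency: no finite conjunction of members of Γ has its negation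
in FOL□. -/
def Consistent (Γ : Set Formula) : Prop :=
  ∀ L : List Formula, L ≠ [] → (∀ B ∈ L, B ∈ Γ) → ¬ FOLBox (neg (conjList L))

/-- Maximal FOL□-consistency. -/
def MaxConsistent (Γ : Set Formula) : Prop :=
  Consistent Γ ∧ ∀ A, A ∈ Γ ∨ neg A ∈ Γ

/-- ∃-saturation: whenever ¬∀xA ∈ Γ there is a variable y with
¬A(y/x) ∈ Γ via a ∀□-free substitution. -/
def Saturated (Γ : Set Formula) : Prop :=
  ∀ (x : ℕ) (A : Formula), neg (all x A) ∈ Γ →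
    ∃ y : ℕ, Substitutable y x A ∧ neg (A.subst y x) ∈ Γ

/-- MC: the family of all ∃-saturated maximal FOL□-consistent sets. -/
def MC : Set (Set Formula) := {Γ | Saturated Γ ∧ MaxConsistent Γ}

/-- An elementary disjunction: a formula of the form
`A ∨ ◇B ∨ □C₁ ∨ … ∨ □Cₙ` with A, B, C₁, …, Cₙ □-free. -/
def ElemDisj (D : Formula) : Prop :=
  ∃ (A B : Formula) (Cs : List Formula),
    BoxFree A ∧ BoxFree B ∧ (∀ C ∈ Cs, BoxFree C) ∧
    D = (Cs.map Formula.box).foldl Formula.or (A.or B.dia)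

/-- A conjunctive form: a conjunction of elementary disjunctions. -/
def ConjForm (F : Formula) : Prop :=
  ∃ Ds : List Formula, Ds ≠ [] ∧ (∀ D ∈ Ds, ElemDisj D) ∧ F = conjList Ds

/-- The worlds of the canonical structure: members of MC. -/
def MCW : Type := {Γ : Set Formula // Γ ∈ MC}

/-- The relation ∼_Γ on variables: x ∼_Γ y iff the formula x = y belongs
to Γ. -/
def canonRel (Γ : MCW) (x y : ℕ) : Prop := Formula.eq x y ∈ Γ.val

/-- The canonical structure 𝒜^MC: worlds are the members of MC, the domain
of a world Γ consists of the classes [x]_{∼_Γ} of variables, and a predicate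
holds of such classes iff the corresponding atomic formula belongs to Γ. -/
noncomputable def canonicalStructure (h : Nonempty MCW) : Structure where
  W := MCW
  wNonempty := h
  D := fun Γ => Quot (canonRel Γ)
  dNonempty := fun Γ => ⟨Quot.mk _ 0⟩
  I := fun j Γ ds =>
    ∃ xs : List ℕ, ds = xs.map (Quot.mk (canonRel Γ)) ∧ Formula.atom j xs ∈ Γ.val

/-- The canonical valuation v^MC: v^MC(x, Γ) = [x]_{∼_Γ}. -/
noncomputable def canonicalVal (h : Nonempty MCW) : Valuation (canonicalStructure h) :=
  fun x Γ => Quot.mk (canonRel Γ) x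

namespace FOLBox

variable {A B C : Formula}

theorem imp_trans (h₁ : FOLBox (A.imp B)) (h₂ : FOLBox (B.imp C)) : FOLBox (A.imp C) := by
  have t : FOLBox ((A.imp B).imp ((B.imp C).imp (A.imp C))) :=
    taut (by intro f hn hi; simp only [hi]; tauto)
  exact mp (mp t h₁) h₂

theorem imp_refl (A : Formula) : FOLBox (A.imp A) :=
  taut (by intro f hn hi; simp only [hi]; tauto)

theorem imp_of (A : Formula) (h : FOLBox B) : FOLBox (A.imp B) :=
  mp (taut (by intro f hn hi; simp only [hi]; tauto)) h

theorem neg_imp_neg (h : FOLBox (A.imp B)) : FOLBox (B.neg.imp A.neg) :=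
  mp (taut (by intro f hn hi; simp only [hi, hn]; tauto)) h

theorem curry (h : FOLBox ((A.and B).imp C)) : FOLBox (A.imp (B.imp C)) :=
  mp (taut (by intro f hn hi; simp only [Formula.and, hi, hn]; tauto)) h

theorem box_mono (h : FOLBox (A.imp B)) : FOLBox (A.box.imp B.box) :=
  mp axK (nec h)

theorem gen (x : ℕ) (h : FOLBox A) : FOLBox (all x A) :=
  mp axMix (nec h)

theorem imp_all {x : ℕ} (hx : ¬ FreeIn x A) (h : FOLBox (A.imp B)) :
    FOLBox (A.imp (all x B)) :=
  mp (axAll2 hx) (gen x h)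

theorem subst_of_substitutable {x y : ℕ} (hs : Substitutable y x A) (h : FOLBox A) :
    FOLBox (A.subst y x) :=
  mp (axAll1 hs) (gen x h)

theorem imp_congr {A' B' : Formula} (hA : FOLBox (A'.imp A)) (hB : FOLBox (B.imp B')) :
    FOLBox ((A.imp B).imp (A'.imp B')) :=
  mp (mp (taut (by intro f hn hi; simp only [hi]; tauto)) hA) hB

end FOLBox

namespace Formula

theorem subst_self (A : Formula) (x : ℕ) : A.subst x x = A := by
  have hx : ∀ z, (if z = x then x else z) = z := fun z => by split_ifs <;> omega
  induction A with
  | atom j l => simp [subst, hx]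
  | eq a b => simp [subst, hx]
  | neg A ih => simp [subst, ih]
  | imp A B ihA ihB => simp [subst, ihA, ihB]
  | all z A ih => simp [subst, ih]
  | box A => rfl

theorem substitutable_self (A : Formula) (x : ℕ) : Substitutable x x A := by
  induction A with
  | atom j l => trivial
  | eq a b => trivial
  | neg A ih => exact ih
  | imp A B ihA ihB => exact ⟨ihA, ihB⟩
  | all z A ih =>
    by_cases h : z = x
    · exact Or.inl h
    · exact Or.inr (Or.inr ⟨h, ih⟩)
  | box A => trivial

theorem _root_.FOLBoxPaper.FOLBox.all_mono (x : ℕ) {A B : Formula} (h : FOLBox (A.imp B)) :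
    FOLBox ((all x A).imp (all x B)) := by
  have hA := FOLBox.axAll1 (substitutable_self A x)
  rw [subst_self] at hA
  exact FOLBox.imp_all (fun hx => hx.1 rfl) (FOLBox.imp_trans hA h)

/-- A variable bound: no variable `y ≥ bound A` occurs, free or quantified, in `A` outside
the scope of `□`. -/
def bound : Formula → ℕ
  | atom _ l => l.sum + 1
  | eq a b => a + b + 1
  | neg A => bound A
  | imp A B => bound A + bound B
  | all z A => z + 1 + bound A
  | box _ => 0

theorem not_freeIn_of_bound_le {A : Formula} {y : ℕ} (h : bound A ≤ y) : ¬ FreeIn y A := by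
  induction A with
  | atom j l =>
    intro hy
    have := List.le_sum_of_mem (show y ∈ l from hy)
    simp only [bound] at h
    omega
  | eq a b => simp only [bound, FreeIn] at *; omega
  | neg A ih => exact ih h
  | imp A B ihA ihB =>
    simp only [bound, FreeIn] at *
    have := ihA (by omega)
    have := ihB (by omega)
    tauto
  | all z A ih =>
    simp only [bound, FreeIn] at *
    have := ih (by omega)
    tauto
  | box A => exact id

theorem substitutable_of_bound_le {A : Formula} {x y : ℕ} (h : bound A ≤ y) :
    Substitutable y x A := by
  induction A with
  | atom j l => trivial
  | eq a b => trivial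
  | neg A ih => exact ih h
  | imp A B ihA ihB =>
    simp only [bound] at h
    exact ⟨ihA (by omega), ihB (by omega)⟩
  | all z A ih =>
    simp only [bound] at h
    exact Or.inr (Or.inr ⟨by omega, ih (by omega)⟩)
  | box A => trivial

theorem subst_of_not_freeIn {A : Formula} {x y : ℕ} (h : ¬ FreeIn x A) : A.subst y x = A := by
  induction A with
  | atom j l =>
    simp only [subst, atom.injEq, true_and]
    refine (List.map_congr_left fun z hz => ?_).trans (List.map_id l)
    have : z ≠ x := fun e => h (e ▸ hz)
    simp [this]
  | eq a b =>
    simp only [FreeIn, not_or] at h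
    simp [subst, Ne.symm h.1, Ne.symm h.2]
  | neg A ih => simp [subst, ih h]
  | imp A B ihA ihB =>
    simp only [FreeIn, not_or] at h
    simp [subst, ihA h.1, ihB h.2]
  | all z A ih =>
    simp only [subst]
    split_ifs with hz
    · rfl
    · rw [ih fun hA => h ⟨hz, hA⟩]
  | box A => rfl

theorem subst_subst_of_bound_le {A : Formula} {x y : ℕ} (h : bound A ≤ y) :
    (A.subst y x).subst x y = A := by
  induction A with
  | atom j l =>
    simp only [subst, List.map_map, atom.injEq, true_and]
    refine (List.map_congr_left fun z hz => ?_).trans (List.map_id l)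
    have := List.le_sum_of_mem hz
    simp only [bound] at h
    have : z ≠ y := by omega
    by_cases hzx : z = x <;> simp [hzx]
    omega
  | eq a b =>
    simp only [bound] at h
    simp only [subst, eq.injEq]
    constructor <;> split_ifs <;> omega
  | neg A ih => simp [subst, ih h]
  | imp A B ihA ihB =>
    simp only [bound] at h
    simp [subst, ihA (by omega), ihB (by omega)]
  | all z A ih =>
    have h' := h
    simp only [bound] at h
    by_cases hz : z = x
    · have : (all z A).subst y x = all z A := by simp [subst, hz]
      rw [this, subst_of_not_freeIn (not_freeIn_of_bound_le h')]
    · have : z ≠ y := by omega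
      simp [subst, hz, this, ih (by omega)]
  | box A => rfl

theorem substitutable_subst_of_bound_le {A : Formula} {x y : ℕ} (h : bound A ≤ y) :
    Substitutable x y (A.subst y x) := by
  induction A with
  | atom j l => trivial
  | eq a b => trivial
  | neg A ih => exact ih h
  | imp A B ihA ihB =>
    simp only [bound] at h
    exact ⟨ihA (by omega), ihB (by omega)⟩
  | all z A ih =>
    simp only [bound] at h
    simp only [subst]
    split_ifs with hz
    · exact Or.inr (Or.inl (not_freeIn_of_bound_le (by omega)))
    · exact Or.inr (Or.inr ⟨hz, ih (by omega)⟩)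
  | box A => trivial

theorem not_freeIn_subst {A : Formula} {x y : ℕ} (hxy : y ≠ x) : ¬ FreeIn x (A.subst y x) := by
  induction A with
  | atom j l =>
    simp only [subst, FreeIn, List.mem_map, not_exists, not_and]
    intro z _
    split_ifs with hz
    · exact hxy
    · exact hz
  | eq a b =>
    simp only [subst, FreeIn]
    split_ifs <;> omega
  | neg A ih => exact ih
  | imp A B ihA ihB => exact fun h => h.elim ihA ihB
  | all z A ih =>
    simp only [subst]
    split_ifs with hz
    · exact fun h => h.1 hz
    · exact fun h => ih h.2
  | box A => exact id

theorem BoxFree.subst {A : Formula} (h : BoxFree A) (y x : ℕ) : BoxFree (A.subst y x) := by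
  induction A with
  | atom j l => trivial
  | eq a b => trivial
  | neg A ih => exact ih h
  | imp A B ihA ihB => exact ⟨ihA h.1, ihB h.2⟩
  | all z A ih =>
    simp only [Formula.subst]
    split_ifs
    · exact h
    · exact ih h
  | box A => exact h

/-- The number of connectives, quantifiers and boxes. -/
def size : Formula → ℕ
  | atom _ _ => 0
  | eq _ _ => 0
  | neg A => size A + 1
  | imp A B => size A + size B + 1
  | all _ A => size A + 1
  | box A => size A + 1

theorem size_subst (A : Formula) (y x : ℕ) : (A.subst y x).size = A.size := by
  induction A with
  | atom j l => rfl
  | eq a b => rfl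
  | neg A ih => simp [subst, size, ih]
  | imp A B ihA ihB => simp [subst, size, ihA, ihB]
  | all z A ih =>
    simp only [subst]
    split_ifs
    · rfl
    · simp [size, ih]
  | box A => rfl

/-- The variable `y` is not quantified in `A` outside the scope of `□`. -/
def NotBound (y : ℕ) : Formula → Prop
  | atom _ _ => True
  | eq _ _ => True
  | neg A => NotBound y A
  | imp A B => NotBound y A ∧ NotBound y B
  | all z A => z ≠ y ∧ NotBound y A
  | box _ => True

theorem NotBound.substitutable {A : Formula} {y : ℕ} (h : NotBound y A) (x : ℕ) :
    Substitutable y x A := by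
  induction A with
  | atom j l => trivial
  | eq a b => trivial
  | neg A ih => exact ih h
  | imp A B ihA ihB => exact ⟨ihA h.1, ihB h.2⟩
  | all z A ih => exact Or.inr (Or.inr ⟨h.1, ih h.2⟩)
  | box A => trivial

theorem NotBound.subst {A : Formula} {u : ℕ} (h : NotBound u A) (y x : ℕ) :
    NotBound u (A.subst y x) := by
  induction A with
  | atom j l => trivial
  | eq a b => trivial
  | neg A ih => exact ih h
  | imp A B ihA ihB => exact ⟨ihA h.1, ihB h.2⟩
  | all z A ih =>
    simp only [Formula.subst]
    split_ifs
    · exact h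
    · exact ⟨h.1, ih h.2⟩
  | box A => trivial

/-- Truth of a formula in a one-sorted first-order structure; boxed formulas count as false. -/
def Holds {D : Type} (I : ℕ → List D → Prop) : (ℕ → D) → Formula → Prop
  | e, atom j l => I j (l.map e)
  | e, eq a b => e a = e b
  | e, neg A => ¬ Holds I e A
  | e, imp A B => Holds I e A → Holds I e B
  | e, all x A => ∀ d, Holds I (Function.update e x d) A
  | _, box _ => False

theorem holds_congr {D : Type} (I : ℕ → List D → Prop) {A : Formula} {e e' : ℕ → D}
    (h : ∀ z, FreeIn z A → e z = e' z) : Holds I e A ↔ Holds I e' A := by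
  induction A generalizing e e' with
  | atom j l =>
    simp only [Holds]
    rw [List.map_congr_left h]
  | eq a b =>
    simp only [Holds]
    rw [h a (Or.inl rfl), h b (Or.inr rfl)]
  | neg A ih => exact not_congr (ih h)
  | imp A B ihA ihB =>
    exact imp_congr (ihA fun z hz => h z (Or.inl hz)) (ihB fun z hz => h z (Or.inr hz))
  | all x A ih =>
    refine forall_congr' fun d => ih fun z hz => ?_
    by_cases hzx : z = x
    · subst hzx; simp
    · simp [hzx, h z ⟨Ne.symm hzx, hz⟩]
  | box A => rfl

theorem holds_subst {D : Type} (I : ℕ → List D → Prop) {A : Formula} {x y : ℕ} {e : ℕ → D}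
    (h : Substitutable y x A) :
    Holds I e (A.subst y x) ↔ Holds I (Function.update e x (e y)) A := by
  induction A generalizing e with
  | atom j l =>
    simp only [Holds, subst, List.map_map]
    rw [List.map_congr_left]
    intro z _
    by_cases hz : z = x <;> simp [hz]
  | eq a b =>
    simp only [Holds, subst]
    by_cases ha : a = x <;> by_cases hb : b = x <;> simp [ha, hb]
  | neg A ih => exact not_congr (ih h)
  | imp A B ihA ihB => exact imp_congr (ihA h.1) (ihB h.2)
  | all z A ih =>
    by_cases hx : FreeIn x (all z A)
    · obtain ⟨hzx, hA⟩ := hx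
      obtain ⟨hzy, hs⟩ : z ≠ y ∧ Substitutable y x A := by
        rcases h with h | h | h
        · exact absurd h hzx
        · exact absurd hA h
        · exact h
      simp only [subst, if_neg hzx, Holds]
      refine forall_congr' fun d => ?_
      rw [ih hs, Function.update_of_ne hzy.symm, Function.update_comm hzx]
    · rw [subst_of_not_freeIn hx]
      refine holds_congr I fun u hu => ?_
      have : u ≠ x := fun e => hx (e ▸ hu)
      simp [this]
  | box A => rfl

/-- Alphabetic variants: the quantified variables of `A` can be renamed away from `y`,
preserving `A` up to provable and semantic equivalence. -/
theorem exists_notBound_variant (y : ℕ) (A : Formula) : ∃ A' : Formula,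
    NotBound y A' ∧ (BoxFree A → BoxFree A') ∧ A'.size = A.size ∧
    FOLBox (A.imp A') ∧ FOLBox (A'.imp A) ∧
    ∀ (D : Type) (I : ℕ → List D → Prop) (e : ℕ → D), Holds I e A' ↔ Holds I e A := by
  induction A with
  | atom j l =>
    exact ⟨atom j l, trivial, id, rfl, FOLBox.imp_refl _, FOLBox.imp_refl _,
      fun _ _ _ => Iff.rfl⟩
  | eq a b =>
    exact ⟨eq a b, trivial, id, rfl, FOLBox.imp_refl _, FOLBox.imp_refl _, fun _ _ _ => Iff.rfl⟩
  | box A =>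
    exact ⟨box A, trivial, id, rfl, FOLBox.imp_refl _, FOLBox.imp_refl _, fun _ _ _ => Iff.rfl⟩
  | neg A ih =>
    obtain ⟨A', hy, hb, hs, h₁, h₂, he⟩ := ih
    exact ⟨neg A', hy, hb, by simp [size, hs], FOLBox.neg_imp_neg h₂, FOLBox.neg_imp_neg h₁,
      fun D I e => not_congr (he D I e)⟩
  | imp A B ihA ihB =>
    obtain ⟨A', hy, hb, hs, h₁, h₂, he⟩ := ihA
    obtain ⟨B', hy', hb', hs', h₁', h₂', he'⟩ := ihB
    exact ⟨imp A' B', ⟨hy, hy'⟩, fun h => ⟨hb h.1, hb' h.2⟩, by simp [size, hs, hs'],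
      FOLBox.imp_congr h₂ h₁', FOLBox.imp_congr h₁ h₂',
      fun D I e => _root_.imp_congr (he D I e) (he' D I e)⟩
  | all z A ih =>
    obtain ⟨A', hy, hb, hs, h₁, h₂, he⟩ := ih
    by_cases hz : z = y
    · subst hz
      obtain ⟨w, hw, hzw⟩ : ∃ w, bound A' ≤ w ∧ w ≠ z := ⟨bound A' + z + 1, by omega, by omega⟩
      have hzA : ¬ FreeIn z (all w (A'.subst w z)) := fun h => not_freeIn_subst hzw h.2
      have hwA : ¬ FreeIn w (all z A') := fun h => not_freeIn_of_bound_le hw h.2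
      have hback := FOLBox.axAll1 (substitutable_subst_of_bound_le (x := z) hw)
      rw [subst_subst_of_bound_le hw] at hback
      refine ⟨all w (A'.subst w z), ⟨hzw, hy.subst _ _⟩, fun h => (hb h).subst _ _,
        by simp [size, size_subst, hs], ?_, ?_, ?_⟩
      · exact FOLBox.imp_trans (FOLBox.all_mono z h₁)
          (FOLBox.imp_all hwA (FOLBox.axAll1 (substitutable_of_bound_le hw)))
      · exact FOLBox.imp_trans (FOLBox.imp_all hzA hback) (FOLBox.all_mono z h₂)
      · intro D I e
        refine forall_congr' fun d => ?_
        rw [holds_subst I (substitutable_of_bound_le hw), ← he, Function.update_self]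
        refine holds_congr I fun u hu => ?_
        have huw : u ≠ w := fun e => not_freeIn_of_bound_le hw (e ▸ hu)
        by_cases huz : u = z
        · subst huz; simp
        · simp [huz, huw]
    · exact ⟨all z A', ⟨hz, hy⟩, hb, by simp [size, hs], FOLBox.all_mono z h₁,
        FOLBox.all_mono z h₂, fun D I e => forall_congr' fun d => he D I _⟩

/-- A numerical code of a formula. -/
def code : Formula → ℕ
  | atom j l => Nat.pair 0 (Nat.pair j (Encodable.encode l))
  | eq a b => Nat.pair 1 (Nat.pair a b)
  | neg A => Nat.pair 2 (code A)
  | imp A B => Nat.pair 3 (Nat.pair (code A) (code B))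
  | all x A => Nat.pair 4 (Nat.pair x (code A))
  | box A => Nat.pair 5 (code A)

theorem code_injective : Function.Injective code := by
  intro A
  induction A with
  | atom j l => intro B h; cases B <;> simp_all [code]
  | eq a b => intro B h; cases B <;> simp_all [code]
  | neg A ih =>
    intro B h
    cases B <;> simp only [code, Nat.pair_eq_pair] at h <;> first | omega | rw [ih h.2]
  | imp A B ihA ihB =>
    intro B h
    cases B <;> simp only [code, Nat.pair_eq_pair] at h <;>
      first | omega | rw [ihA h.2.1, ihB h.2.2]
  | all x A ih =>
    intro B h
    cases B <;> simp only [code, Nat.pair_eq_pair] at h <;>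
      first | omega | rw [h.2.1, ih h.2.2]
  | box A ih =>
    intro B h
    cases B <;> simp only [code, Nat.pair_eq_pair] at h <;> first | omega | rw [ih h.2]

instance : Countable Formula := code_injective.countable

instance : Nonempty Formula := ⟨eq 0 0⟩

end Formula

/-- Every box-free thesis of FOL holds in every one-sorted first-order structure. -/
theorem holds_of_mem_FOL {A : Formula} (hA : A ∈ FOL) {D : Type} (I : ℕ → List D → Prop)
    (e : ℕ → D) : Holds I e A := by
  let M : Structure := ⟨Unit, ⟨()⟩, fun _ => D, fun _ => ⟨e 0⟩, fun j _ => I j⟩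
  have key : ∀ B, BoxFree B → ∀ v : Valuation M,
      Sat M v () B ↔ Holds I (fun z => v z ()) B := by
    intro B
    induction B with
    | atom j l => exact fun _ v => Iff.rfl
    | eq a b => exact fun _ v => Iff.rfl
    | neg B ih => exact fun h v => not_congr (ih h v)
    | imp B C ihB ihC => exact fun h v => imp_congr (ihB h.1 v) (ihC h.2 v)
    | all x B ih =>
      intro h v
      refine forall_congr' fun d => (ih h _).trans ?_
      have : (fun z => updateVal v x () d z ()) = Function.update (fun z => v z ()) x d := by
        funext z
        by_cases hz : z = x
        · subst hz; simp [updateVal]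
        · simp [updateVal, hz]
      exact this ▸ Iff.rfl
    | box B => exact fun h => h.elim
  exact (key A hA.1 fun z _ => e z).1 (hA.2 M _ _)

/-- Complete, consistent, ∃-saturated theories closed under FOL□-derivability. -/
structure IsHenkin (Θ : Set Formula) : Prop where
  thm : ∀ {A}, FOLBox A → A ∈ Θ
  mp : ∀ {A B}, A.imp B ∈ Θ → A ∈ Θ → B ∈ Θ
  not_both : ∀ {A}, A ∈ Θ → A.neg ∉ Θ
  total : ∀ A, A ∈ Θ ∨ A.neg ∈ Θ
  saturated : Saturated Θ

theorem exists_consistent_extension {F : Formula} (hF : ¬ FOLBox F.neg) (A : Formula) :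
    ∃ G : Formula, ¬ FOLBox G.neg ∧ FOLBox (G.imp F) ∧
      (FOLBox (G.imp A) ∨ FOLBox (G.imp A.neg)) ∧
      ∀ x B, A = all x B → FOLBox (G.imp A.neg) →
        ∃ y, Substitutable y x B ∧ FOLBox (G.imp (B.subst y x).neg) := by
  have andl : ∀ B C : Formula, FOLBox ((B.and C).imp B) := fun B C =>
    FOLBox.taut (by intro f hn hi; simp only [Formula.and, hi, hn]; tauto)
  have andr : ∀ B C : Formula, FOLBox ((B.and C).imp C) := fun B C =>
    FOLBox.taut (by intro f hn hi; simp only [Formula.and, hi, hn]; tauto)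
  have absurd' : ∀ {B C : Formula}, FOLBox (B.imp C) → FOLBox (B.imp C.neg) → FOLBox B.neg :=
    fun h₁ h₂ => FOLBox.mp (FOLBox.mp
      (FOLBox.taut (by intro f hn hi; simp only [hi, hn]; tauto)) h₁) h₂
  by_cases hA : FOLBox (F.and A).neg
  · have hFA : FOLBox (F.imp A.neg) :=
      FOLBox.mp (FOLBox.taut (by
        intro f hn hi; simp only [Formula.and, hi, hn]; tauto)) hA
    by_cases hall : ∃ x B, A = all x B
    · obtain ⟨x, B, rfl⟩ := hall
      obtain ⟨y, hyF, hyB, hxy⟩ : ∃ y, bound F ≤ y ∧ bound B ≤ y ∧ y ≠ x :=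
        ⟨bound F + bound B + x + 1, by omega, by omega, by omega⟩
      have hback := FOLBox.axAll1 (substitutable_subst_of_bound_le (x := x) hyB)
      rw [subst_subst_of_bound_le hyB] at hback
      have hx : ¬ FreeIn x (all y (B.subst y x)) := fun h => not_freeIn_subst hxy h.2
      refine ⟨F.and (B.subst y x).neg, fun h => hF ?_, andl _ _,
        Or.inr (FOLBox.imp_trans (andl _ _) hFA), ?_⟩
      · have h' : FOLBox (F.imp (B.subst y x)) :=
          FOLBox.mp (FOLBox.taut (by
            intro f hn hi; simp only [Formula.and, hi, hn]; tauto)) h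
        have h'' := FOLBox.imp_all (not_freeIn_of_bound_le hyF) h'
        exact absurd' (FOLBox.imp_trans h'' (FOLBox.imp_all hx hback)) hFA
      · intro x' B' hB _
        cases hB
        exact ⟨y, substitutable_of_bound_le hyB, andr _ _⟩
    · exact ⟨F, hF, FOLBox.imp_refl F, Or.inr hFA, fun x B h => (hall ⟨x, B, h⟩).elim⟩
  · refine ⟨F.and A, hA, andl _ _, Or.inl (andr _ _), fun x B _ h => (hA ?_).elim⟩
    exact absurd' (andr _ _) h

theorem exists_isHenkin {F : Formula} (hF : ¬ FOLBox F.neg) :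
    ∃ Θ : Set Formula, IsHenkin Θ ∧ F ∈ Θ := by
  choose next hcons hext hdec hsat using
    fun (S : {G : Formula // ¬ FOLBox G.neg}) A => exists_consistent_extension S.2 A
  obtain ⟨enum, henum⟩ := exists_surjective_nat Formula
  let s : ℕ → {G : Formula // ¬ FOLBox G.neg} :=
    Nat.rec ⟨F, hF⟩ fun n S => ⟨next S (enum n), hcons S (enum n)⟩
  have hmono : ∀ m k, FOLBox ((s (m + k)).1.imp (s m).1) := by
    intro m k
    induction k with
    | zero => exact FOLBox.imp_refl _
    | succ k ih => exact FOLBox.imp_trans (hext (s (m + k)) (enum (m + k))) ih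
  have hle : ∀ {m n A}, m ≤ n → FOLBox ((s m).1.imp A) → FOLBox ((s n).1.imp A) := by
    intro m n A h hA
    obtain ⟨k, rfl⟩ := Nat.exists_eq_add_of_le h
    exact FOLBox.imp_trans (hmono m k) hA
  have hboth : ∀ {m n A}, FOLBox ((s m).1.imp A) → ¬ FOLBox ((s n).1.imp A.neg) := by
    intro m n A h₁ h₂
    refine (s (max m n)).2 (FOLBox.mp (FOLBox.mp (FOLBox.taut ?_)
      (hle (le_max_left m n) h₁)) (hle (le_max_right m n) h₂))
    intro f hn hi; simp only [hi, hn]; tauto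
  refine ⟨{A | ∃ n, FOLBox ((s n).1.imp A)}, ⟨?_, ?_, ?_, ?_, ?_⟩, 0, FOLBox.imp_refl F⟩
  · exact fun h => ⟨0, FOLBox.imp_of _ h⟩
  · rintro A B ⟨m, h₁⟩ ⟨n, h₂⟩
    refine ⟨max m n, FOLBox.mp (FOLBox.mp (FOLBox.taut ?_)
      (hle (le_max_left m n) h₁)) (hle (le_max_right m n) h₂)⟩
    intro f hn hi; simp only [hi]; tauto
  · rintro A ⟨m, h₁⟩ ⟨n, h₂⟩
    exact hboth h₁ h₂
  · intro A
    obtain ⟨n, rfl⟩ := henum A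
    exact (hdec (s n) (enum n)).imp (fun h => ⟨n + 1, h⟩) fun h => ⟨n + 1, h⟩
  · rintro x A ⟨m, h⟩
    obtain ⟨n, hn⟩ := henum (all x A)
    have hneg : FOLBox ((next (s n) (enum n)).imp (enum n).neg) := by
      refine (hdec (s n) (enum n)).resolve_left fun h' => ?_
      rw [hn] at h'
      exact hboth (m := n + 1) (show FOLBox ((s (n + 1)).1.imp (all x A)) by
        simpa only [s, hn] using h') h
    obtain ⟨y, hy, hB⟩ := hsat (s n) (enum n) x A hn hneg
    exact ⟨y, hy, n + 1, hB⟩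

theorem FOLBox.eq_euclid (x y z : ℕ) :
    FOLBox ((eq x y).imp ((eq x z).imp (eq y z))) := by
  obtain ⟨u, hx, hy, hz⟩ : ∃ u, x ≠ u ∧ y ≠ u ∧ z ≠ u :=
    ⟨x + y + z + 1, by omega, by omega, by omega⟩
  have h := curry (axEq (A := eq u z) (x := u) (y := y) trivial trivial)
  have h' := subst_of_substitutable (x := u) (y := x)
    (A := (eq u y).imp ((eq u z).imp ((eq u z).subst y u)))
    ⟨trivial, trivial, trivial⟩ h
  simpa [Formula.subst, hx, hy, hz] using h'

theorem FOLBox.eq_atom (x y j : ℕ) (l₁ l₂ : List ℕ) :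
    FOLBox ((eq x y).imp ((atom j (l₁ ++ x :: l₂)).imp (atom j (l₁ ++ y :: l₂)))) := by
  obtain ⟨u, hx, hy, h₁, h₂⟩ : ∃ u, x ≠ u ∧ y ≠ u ∧ l₁.sum < u ∧ l₂.sum < u :=
    ⟨x + y + l₁.sum + l₂.sum + 1, by omega, by omega, by omega, by omega⟩
  have hmap : ∀ (w : ℕ) {l : List ℕ}, l.sum < u →
      l.map (fun z => if z = u then w else z) = l := by
    intro w l hl
    refine (List.map_congr_left fun z hz => ?_).trans (List.map_id l)
    have := List.le_sum_of_mem hz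
    have : z ≠ u := by omega
    simp [this]
  have h := curry (axEq (A := atom j (l₁ ++ u :: l₂)) (x := u) (y := y) trivial trivial)
  have h' := subst_of_substitutable (x := u) (y := x)
    (A := (eq u y).imp ((atom j (l₁ ++ u :: l₂)).imp ((atom j (l₁ ++ u :: l₂)).subst y u)))
    ⟨trivial, trivial, trivial⟩ h
  simpa [Formula.subst, hy, hmap _ h₁, hmap _ h₂] using h'

namespace IsHenkin

variable {Θ : Set Formula}

theorem neg_mem_iff (h : IsHenkin Θ) (A : Formula) : A.neg ∈ Θ ↔ A ∉ Θ :=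
  ⟨fun h₁ h₂ => h.not_both h₂ h₁, fun h₁ => (h.total A).resolve_left h₁⟩

theorem imp_mem_iff (h : IsHenkin Θ) (A B : Formula) : A.imp B ∈ Θ ↔ (A ∈ Θ → B ∈ Θ) := by
  refine ⟨h.mp, fun hAB => ?_⟩
  rcases h.total A with hA | hA
  · exact h.mp (h.thm (FOLBox.taut (by intro f hn hi; simp only [hi]; tauto))) (hAB hA)
  · exact h.mp (h.thm (FOLBox.taut (by intro f hn hi; simp only [hi, hn]; tauto))) hA

/-- Provable identity of variables in `Θ`. -/
def setoid (h : IsHenkin Θ) : Setoid ℕ where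
  r x y := eq x y ∈ Θ
  iseqv := by
    have symm : ∀ {x y}, eq x y ∈ Θ → eq y x ∈ Θ := fun {x y} hxy =>
      h.mp (h.mp (h.thm (FOLBox.eq_euclid x y x)) hxy) (h.thm FOLBox.axId)
    exact ⟨fun _ => h.thm FOLBox.axId, symm, fun {x y z} hxy hyz =>
      h.mp (h.mp (h.thm (FOLBox.eq_euclid y x z)) (symm hxy)) hyz⟩

theorem atom_mem (h : IsHenkin Θ) (j : ℕ) {l l' : List ℕ}
    (hl : List.Forall₂ (fun x y => eq x y ∈ Θ) l l') (l₀ : List ℕ)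
    (hat : atom j (l₀ ++ l) ∈ Θ) : atom j (l₀ ++ l') ∈ Θ := by
  induction hl generalizing l₀ with
  | nil => exact hat
  | @cons x y l l' hxy _ ih =>
    have := ih (l₀ ++ [y]) (by
      simpa using h.mp (h.mp (h.thm (FOLBox.eq_atom x y j l₀ l)) hxy) hat)
    simpa using this

theorem holds_iff_mem (h : IsHenkin Θ) {A : Formula} (hA : BoxFree A) :
    Holds (fun j ds => ∃ xs : List ℕ, ds = xs.map (Quotient.mk h.setoid) ∧ atom j xs ∈ Θ)
      (Quotient.mk h.setoid) A ↔ A ∈ Θ := by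
  induction hn : A.size using Nat.strong_induction_on generalizing A with
  | _ n ih =>
    cases A with
    | atom j l =>
      refine ⟨fun ⟨xs, hxs, hat⟩ => h.atom_mem j ?_ [] hat, fun hat => ⟨l, rfl, hat⟩⟩
      have := List.forall₂_eq_eq_eq.symm ▸ hxs.symm
      rw [List.forall₂_map_left_iff, List.forall₂_map_right_iff] at this
      exact this.imp fun _ _ hxy => Quotient.exact hxy
    | eq a b => exact ⟨fun hab => Quotient.exact hab, fun hab => Quotient.sound hab⟩
    | neg A =>
      simp only [size] at hn
      rw [h.neg_mem_iff, ← ih A.size (by omega) (A := A) hA rfl]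
      rfl
    | imp A B =>
      simp only [size] at hn
      rw [h.imp_mem_iff, ← ih A.size (by omega) hA.1 rfl, ← ih B.size (by omega) hA.2 rfl]
      rfl
    | all x A =>
      simp only [size] at hn
      constructor
      · intro hall
        by_contra hnot
        obtain ⟨y, hy, hneg⟩ := h.saturated x A ((h.neg_mem_iff _).2 hnot)
        refine (h.neg_mem_iff _).1 hneg ((ih A.size (by omega)
          (BoxFree.subst (A := A) hA y x) (size_subst A y x)).1 ?_)
        exact (holds_subst _ hy).2 (hall _)
      · intro hmem d
        obtain ⟨y, rfl⟩ := Quotient.exists_rep d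
        obtain ⟨A', hy, hb, hs, h₁, -, he⟩ := exists_notBound_variant y A
        have hsub := hy.substitutable x
        rw [← he, ← holds_subst _ hsub, ih A.size (by omega) ((hb hA).subst y x)
          ((size_subst A' y x).trans hs)]
        exact h.mp (h.thm (FOLBox.imp_trans (FOLBox.all_mono x h₁) (FOLBox.axAll1 hsub))) hmem
    | box A => exact hA.elim

end IsHenkin

/-- Completeness for the `□`-free fragment. -/
theorem FOLBox.of_mem_FOL {A : Formula} (hA : A ∈ FOL) : FOLBox A := by
  by_contra hnot
  have hcons : ¬ FOLBox A.neg.neg := fun h =>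
    hnot (mp (taut (by intro f hn hi; simp only [hi, hn]; tauto)) h)
  obtain ⟨Θ, h, hneg⟩ := exists_isHenkin hcons
  exact h.not_both ((h.holds_iff_mem hA.1).1 (holds_of_mem_FOL hA _ _)) hneg

/-- Every formula is provably equivalent to a `□`-free one. -/
theorem exists_boxFree_equiv (A : Formula) :
    ∃ A' : Formula, BoxFree A' ∧ FOLBox (A.imp A') ∧ FOLBox (A'.imp A) := by
  induction A with
  | atom j l => exact ⟨atom j l, trivial, FOLBox.imp_refl _, FOLBox.imp_refl _⟩
  | eq a b => exact ⟨eq a b, trivial, FOLBox.imp_refl _, FOLBox.imp_refl _⟩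
  | neg A ih =>
    obtain ⟨A', hb, h₁, h₂⟩ := ih
    exact ⟨neg A', hb, FOLBox.neg_imp_neg h₂, FOLBox.neg_imp_neg h₁⟩
  | imp A B ihA ihB =>
    obtain ⟨A', hb, h₁, h₂⟩ := ihA
    obtain ⟨B', hb', h₁', h₂'⟩ := ihB
    exact ⟨imp A' B', ⟨hb, hb'⟩, FOLBox.imp_congr h₂ h₁', FOLBox.imp_congr h₁ h₂'⟩
  | all x A ih =>
    obtain ⟨A', hb, h₁, h₂⟩ := ih
    exact ⟨all x A', hb, FOLBox.all_mono x h₁, FOLBox.all_mono x h₂⟩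
  | box A ih =>
    obtain ⟨A', hb, h₁, h₂⟩ := ih
    by_cases hF : A' ∈ FOL
    · exact ⟨eq 0 0, trivial, FOLBox.imp_of _ FOLBox.axId,
        FOLBox.imp_of _ (FOLBox.nec (FOLBox.mp h₂ (FOLBox.of_mem_FOL hF)))⟩
    · have hneg := FOLBox.mp (FOLBox.neg_imp_neg (FOLBox.box_mono h₁)) (FOLBox.axBang hb hF)
      exact ⟨neg (eq 0 0), trivial,
        FOLBox.mp (FOLBox.taut (by intro f hn hi; simp only [hi, hn]; tauto)) hneg,
        FOLBox.mp (FOLBox.taut (by intro f hn hi; simp only [hi, hn]; tauto))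
          (FOLBox.axId (x := 0))⟩

/-- FOL□ decides every boxed formula. -/
theorem FOLBox.thm_or_neg_box (A : Formula) : FOLBox A ∨ FOLBox A.box.neg := by
  obtain ⟨A', hb, h₁, h₂⟩ := exists_boxFree_equiv A
  by_cases hF : A' ∈ FOL
  · exact Or.inl (mp h₂ (of_mem_FOL hF))
  · exact Or.inr (mp (neg_imp_neg (box_mono h₁)) (axBang hb hF))

/-- Universality of the canonical accessibility relation:
for all Γ, Δ ∈ MC and every formula A, if □A ∈ Γ then A ∈ Δ. -/
theorem canonical_relation_universal (Γ Δ : Set Formula)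
    (hΓ : Γ ∈ MC) (hΔ : Δ ∈ MC) (A : Formula) (hA : Formula.box A ∈ Γ) :
    A ∈ Δ := by
  rcases FOLBox.thm_or_neg_box A with h | h
  · refine (hΔ.2.2 A).resolve_right fun hneg => hΔ.2.1 [A.neg] (by simp) (by simpa using hneg) ?_
    exact FOLBox.mp (FOLBox.taut (by intro f hn hi; simp only [hi, hn, conjList]; tauto)) h
  · exact (hΓ.2.1 [A.box] (by simp) (by simpa using hA) h).elim

end FOLBoxPaper
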